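/- arXiv:math/0206263 — 6 statements merged into one kernel-verified Lean document; each statement's English description precedes it below -/
import Mathlib

section
/- Let w be a word of length m and i ∈ I. If e_i(w) is defined, then N(e_i(w)) ≡ N(w) − δ_{i,0} (mod m). If f_i(w) is defined, then N(f_i(w)) ≡ N(w) + δ_{i,0} (mod m). -/
open Finset Polynomial

namespace GreensteinPaths

noncomputable section

attribute [local instance] Classical.propDecidable

variable {ℓ m : ℕ}

/-- The Kashiwara function `R^i_p(w)` (positions are 0-based: index `p` is
the mathematical position `p+1`, i.e. the `(p+1)`-th tensor factor counted
from the right). -/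
def Rf (i : ZMod (ℓ + 1)) (w : Fin m → ZMod (ℓ + 1)) (p : Fin m) : ℤ :=
    (if i = w p then 1 else 0)
  + ∑ s ∈ univ.filter (fun s : Fin m => p < s),
      ((if i = w s then 1 else 0) - (if i = w s + 1 then 1 else 0))

/-- `ε_i(w) = max_p R^i_p(w)` (the maximum is nonnegative for `m ≥ 1`,
so we may record it as a natural number). -/
def eps (i : ZMod (ℓ + 1)) (w : Fin m → ZMod (ℓ + 1)) : ℕ :=
  univ.sup fun p => (Rf i w p).toNat

/-- `φ_i(w) = ε_i(w) + Σ_s (δ_{i,w_s+1} − δ_{i,w_s})`. -/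
def phiW (i : ZMod (ℓ + 1)) (w : Fin m → ZMod (ℓ + 1)) : ℤ :=
  (eps i w : ℤ)
    + ∑ s : Fin m, ((if i = w s + 1 then 1 else 0) - (if i = w s then 1 else 0))

/-- The Kashiwara operator `e_i`, as a partial map: take the largest `p`
with `R^i_p(w) = ε_i(w)`; if `w_p = i`, replace it by `i - 1`, otherwise
the result is undefined. -/
def eOp (i : ZMod (ℓ + 1)) (w : Fin m → ZMod (ℓ + 1)) :
    Option (Fin m → ZMod (ℓ + 1)) :=
  WithBot.recBotCoe none
    (fun p => if w p = i then some (Function.update w p (i - 1)) else none)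
    ((univ.filter fun p => Rf i w p = (eps i w : ℤ)).max)

/-- The Kashiwara operator `f_i`, as a partial map: take the smallest `p`
with `R^i_p(w) = ε_i(w)`; if `w_p = i - 1`, replace it by `i`, otherwise
the result is undefined. -/
def fOp (i : ZMod (ℓ + 1)) (w : Fin m → ZMod (ℓ + 1)) :
    Option (Fin m → ZMod (ℓ + 1)) :=
  WithTop.recTopCoe none
    (fun p => if w p = i - 1 then some (Function.update w p i) else none)
    ((univ.filter fun p => Rf i w p = (eps i w : ℤ)).min)

/-- The descent set of a word, 0-based: `r ∈ desc w` corresponds to the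
mathematical descent `r+1` (i.e. `w_{r+1} > w_{r+2}` in 1-based notation),
letters being compared as integers in `{0,…,ℓ}`. -/
def desc (w : Fin m → ZMod (ℓ + 1)) : Finset (Fin m) :=
  univ.filter fun r : Fin m =>
    ∃ h : (r : ℕ) + 1 < m, (w ⟨(r : ℕ) + 1, h⟩).val < (w r).val

/-- `N(w) = Σ_{r=1}^{k} r (n_r − n_{r−1})` where `0 = n_0 < n_1 < ⋯ < n_{k−1} < n_k = m`
and `n_1 < ⋯ < n_{k−1}` are the descents: equivalently the mathematical
position `p` (`1 ≤ p ≤ m`) contributes `1` plus the number of descents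
strictly below `p`. -/
def Nfun (w : Fin m → ZMod (ℓ + 1)) : ℕ :=
  ∑ p : Fin m, (1 + ((desc w).filter fun r => r < p).card)

/-- The major index: the sum of the descents (which are `r+1` for the
0-based `r ∈ desc w`). -/
def MajFun (w : Fin m → ZMod (ℓ + 1)) : ℕ :=
  ∑ r ∈ desc w, ((r : ℕ) + 1)

/-- Content of a word: `content w j` is the number of positions carrying the letter `j`. -/
def content (w : Fin m → ZMod (ℓ + 1)) (j : ZMod (ℓ + 1)) : ℕ :=
  (univ.filter fun p => w p = j).card

/-- The affine operator `ê_i` on pairs `(w, c)`. -/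
def eHat (i : ZMod (ℓ + 1)) (x : (Fin m → ZMod (ℓ + 1)) × ℤ) :
    Option ((Fin m → ZMod (ℓ + 1)) × ℤ) :=
  (eOp i x.1).map fun w' => (w', x.2 + if i = 0 then 1 else 0)

/-- The affine operator `f̂_i` on pairs `(w, c)`. -/
def fHat (i : ZMod (ℓ + 1)) (x : (Fin m → ZMod (ℓ + 1)) × ℤ) :
    Option ((Fin m → ZMod (ℓ + 1)) × ℤ) :=
  (fOp i x.1).map fun w' => (w', x.2 - if i = 0 then 1 else 0)

/-- One application of some `ê_i` or `f̂_i`. -/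
def hatStep (x y : (Fin m → ZMod (ℓ + 1)) × ℤ) : Prop :=
  ∃ i, eHat i x = some y ∨ fHat i x = some y

/-- `Ô_n`: all pairs obtainable from `((0,…,0), n)` by finitely many
applications of the operators `ê_i`, `f̂_i`. -/
def Ohat (n : ℤ) : Set ((Fin m → ZMod (ℓ + 1)) × ℤ) :=
  {x | Relation.ReflTransGen hatStep ((fun _ => 0), n) x}

/-- Successive application of a partial operator along a list of indices
(the head of the list is applied first); the result is defined only if
every intermediate application is defined. -/
def applyList
    (op : ZMod (ℓ + 1) → (Fin m → ZMod (ℓ + 1)) → Option (Fin m → ZMod (ℓ + 1))) :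
    List (ZMod (ℓ + 1)) → (Fin m → ZMod (ℓ + 1)) → Option (Fin m → ZMod (ℓ + 1))
  | [], w => some w
  | i :: is, w => (op i w).bind (applyList op is)

/-- `n`-fold application of `e_i`. -/
def eIter (i : ZMod (ℓ + 1)) : ℕ → (Fin m → ZMod (ℓ + 1)) → Option (Fin m → ZMod (ℓ + 1))
  | 0, w => some w
  | n + 1, w => (eOp i w).bind (eIter i n)

/-- `φ_n(d) = φ(d)·μ(d/g)/φ(d/g)`, `g = gcd(d,|n|)`. -/
def phiInt (n : ℤ) (d : ℕ) : ℚ :=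
  (Nat.totient d : ℚ) * (ArithmeticFunction.moebius (d / Nat.gcd d n.natAbs) : ℚ)
    / (Nat.totient (d / Nat.gcd d n.natAbs) : ℚ)

/-- The multinomial coefficient `(m/d)! / ((k_0/d)! ⋯ (k_ℓ/d)!)`, with the
convention that it is `0` unless all its entries are (nonnegative) integers. -/
def multinomialQ {ι : Type} [Fintype ι] (M : ℕ) (k : ι → ℕ) (d : ℕ) : ℚ :=
  if d ∣ M ∧ ∀ j, d ∣ k j then
    ((M / d).factorial : ℚ) / ∏ j, ((k j / d).factorial : ℚ)
  else 0

/-- `C(k_0,…,k_ℓ; n) = (1/m) Σ_{d ∣ m} φ_n(d) · multinomial(m/d; k_j/d)`. -/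
def Cfun {ι : Type} [Fintype ι] (M : ℕ) (k : ι → ℕ) (n : ℤ) : ℚ :=
  (1 / (M : ℚ)) * ∑ d ∈ M.divisors, phiInt n d * multinomialQ M k d

/-- `C̃(k_0,…,k_ℓ; d) = (d/m) Σ_{d d' ∣ m} μ(d') · multinomial(m/(dd'); k_j/(dd'))`. -/
def Ctil {ι : Type} [Fintype ι] (M : ℕ) (k : ι → ℕ) (d : ℕ) : ℚ :=
  ((d : ℚ) / (M : ℚ)) *
    ∑ d' ∈ M.divisors.filter (fun d' => d * d' ∣ M),
      (ArithmeticFunction.moebius d' : ℚ) * multinomialQ M k (d * d')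

/-- `[n]_q = 1 + q + ⋯ + q^{n−1}` in `ℤ[q]`. -/
def qNat (n : ℕ) : Polynomial ℤ := ∑ i ∈ Finset.range n, X ^ i

/-- `[n]_q! = [n]_q [n−1]_q ⋯ [1]_q`. -/
def qFactorial (n : ℕ) : Polynomial ℤ := ∏ i ∈ Finset.range n, qNat (i + 1)

/-- The Gaussian multinomial `[n; k_1,…,k_r]_q = [n]_q!/([k_1]_q! ⋯ [k_r]_q!)`
(an exact division of polynomials, performed here as division by a monic
polynomial), with the convention that it is `0` if `n ≠ k_1 + ⋯ + k_r`. -/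
def qMultinomial {ι : Type} [Fintype ι] (n : ℕ) (k : ι → ℕ) : Polynomial ℤ :=
  if ∑ j, k j = n then qFactorial n /ₘ ∏ j, qFactorial (k j) else 0

end

section

variable {ℓ m : ℕ}

theorem Rf_eq_succ (i : ZMod (ℓ + 1)) (w : Fin m → ZMod (ℓ + 1)) (p q : Fin m)
    (hpq : (p : ℕ) + 1 = q) :
    Rf i w p = (if i = w p then 1 else 0) + Rf i w q - (if i = w q + 1 then 1 else 0) := by
  have hs : Finset.Ioi p = insert q (Finset.Ioi q) := by
    ext s
    simp only [mem_insert, Finset.mem_Ioi, Fin.lt_def, Fin.ext_iff]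
    omega
  simp only [Rf, Finset.filter_lt_eq_Ioi, hs]
  rw [Finset.sum_insert (by simp)]
  ring

theorem Rf_le_eps (i : ZMod (ℓ + 1)) (w : Fin m → ZMod (ℓ + 1)) (p : Fin m) :
    Rf i w p ≤ eps i w := by
  have h : (Rf i w p).toNat ≤ eps i w :=
    Finset.le_sup (f := fun p => (Rf i w p).toNat) (mem_univ p)
  omega

theorem mem_desc {w : Fin m → ZMod (ℓ + 1)} {r : Fin m} :
    r ∈ desc w ↔ ∃ s : Fin m, (r : ℕ) + 1 = s ∧ (w s).val < (w r).val := by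
  simp only [desc, mem_filter, mem_univ, true_and]
  constructor
  · rintro ⟨h, hlt⟩
    exact ⟨_, rfl, hlt⟩
  · rintro ⟨s, hs, hlt⟩
    have : (⟨(r : ℕ) + 1, hs ▸ s.2⟩ : Fin m) = s := Fin.ext hs
    exact ⟨hs ▸ s.2, by rwa [this]⟩

/-- `N(w) = m(1 + #desc(w)) - maj(w)`. -/
theorem Nfun_eq (w : Fin m → ZMod (ℓ + 1)) :
    (Nfun w : ℤ) = m * (1 + (desc w).card) - MajFun w := by
  have h : ∀ r : Fin m, ((univ.filter fun p : Fin m => r < p).card : ℤ) = m - (r + 1) := by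
    intro r
    rw [Finset.filter_lt_eq_Ioi, Fin.card_Ioi]
    have := r.2
    omega
  have swap : ∑ p : Fin m, ((desc w).filter fun r => r < p).card
      = ∑ r ∈ desc w, (univ.filter fun p : Fin m => r < p).card := by
    simp only [Finset.card_filter]
    exact Finset.sum_comm
  have hN : Nfun w = m + ∑ p : Fin m, ((desc w).filter fun r => r < p).card := by
    unfold Nfun
    rw [Finset.sum_add_distrib]
    congr 1
    · simp
  rw [hN, swap, MajFun]
  push_cast
  simp only [h, Finset.sum_sub_distrib, Finset.sum_const, nsmul_eq_mul]
  ring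

theorem MajFun_eq_sum (w : Fin m → ZMod (ℓ + 1)) :
    (MajFun w : ℤ) = ∑ r : Fin m, if r ∈ desc w then ((r : ℤ) + 1) else 0 := by
  simp [MajFun, Finset.sum_ite_mem]

theorem val_sub_one_of_ne_zero (hℓ : 1 ≤ ℓ) {i : ZMod (ℓ + 1)} (hi : i ≠ 0) :
    (i - 1).val + 1 = i.val := by
  have h1 : (1 : ZMod (ℓ + 1)).val = 1 := ZMod.val_one'' (by omega)
  have hpos : 0 < i.val := Nat.pos_of_ne_zero fun h => hi ((ZMod.val_eq_zero i).1 h)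
  rw [ZMod.val_sub (by omega), h1]
  omega

/-- Lowering a letter `i` to `i - 1 ≠ i`, when the next letter is not `i - 1` and the previous
one is not `i`, preserves `N` modulo `m`, except that for `i = 0` it lowers it by `1`. -/
theorem Nfun_update_modEq (hℓ : 1 ≤ ℓ) (u v : Fin m → ZMod (ℓ + 1)) (i : ZMod (ℓ + 1))
    (p : Fin m) (hu : u p = i) (hv : v p = i - 1) (huv : ∀ s, s ≠ p → v s = u s)
    (hnext : ∀ q : Fin m, (p : ℕ) + 1 = q → u q ≠ i - 1)
    (hprev : ∀ q : Fin m, (q : ℕ) + 1 = p → u q ≠ i) :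
    (Nfun v : ℤ) ≡ (Nfun u : ℤ) - (if i = 0 then 1 else 0) [ZMOD (m : ℤ)] := by
  have hval : ∀ {a b : ZMod (ℓ + 1)}, a ≠ b → a.val ≠ b.val :=
    fun h h' => h (ZMod.val_injective _ h')
  have hoff : ∀ r : Fin m, r ≠ p → (r : ℕ) + 1 ≠ p → (r ∈ desc v ↔ r ∈ desc u) := by
    intro r hr hr'
    simp only [mem_desc]
    refine exists_congr fun s => and_congr_right fun hs => ?_
    rw [huv r hr, huv s (by rintro rfl; exact hr' hs)]
  by_cases hi : i = 0
  · subst hi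
    have hlast : ((0 : ZMod (ℓ + 1)) - 1).val = ℓ := by
      rw [zero_sub]; exact ZMod.val_neg_one ℓ
    have hp_u : p ∉ desc u := by
      rw [mem_desc]
      rintro ⟨s, -, h⟩
      simp [hu] at h
    have hp_v : p ∈ desc v ↔ (p : ℕ) + 1 < m := by
      rw [mem_desc]
      constructor
      · rintro ⟨s, hs, -⟩
        have := s.2
        omega
      · intro h
        refine ⟨⟨p + 1, h⟩, rfl, ?_⟩
        rw [huv _ (by simp [Fin.ext_iff]), hv]
        have h1 := hval (hnext ⟨p + 1, h⟩ rfl)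
        have h2 := ZMod.val_lt (u ⟨p + 1, h⟩)
        omega
    have hq_u : ∀ q : Fin m, (q : ℕ) + 1 = p → q ∈ desc u := by
      intro q hq
      refine mem_desc.2 ⟨p, hq, ?_⟩
      have h1 := hval (hprev q hq)
      rw [hu]
      simp only [ZMod.val_zero] at h1 ⊢
      omega
    have hq_v : ∀ q : Fin m, (q : ℕ) + 1 = p → q ∉ desc v := by
      intro q hq h
      obtain ⟨s, hs, h⟩ := mem_desc.1 h
      obtain rfl : s = p := Fin.ext (by omega)
      rw [hv] at h
      have := ZMod.val_lt (v q)
      omega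
    have hdiff : (MajFun v : ℤ) - MajFun u =
        (∑ r : Fin m, if r = p then (if (p : ℕ) + 1 < m then ((p : ℤ) + 1) else 0) else 0)
          - ∑ r : Fin m, if (r : ℕ) + 1 = p then (p : ℤ) else 0 := by
      rw [MajFun_eq_sum, MajFun_eq_sum, ← Finset.sum_sub_distrib, ← Finset.sum_sub_distrib]
      refine Finset.sum_congr rfl fun r _ => ?_
      by_cases hr : r = p
      · subst hr
        simp [hp_u, hp_v]
      · by_cases hr' : (r : ℕ) + 1 = p
        · simp only [hq_u r hr', hq_v r hr', hr, hr', if_true, if_false]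
          omega
        · simp [hoff r hr hr', hr, hr']
    have hsum : (∑ r : Fin m, if (r : ℕ) + 1 = p then (p : ℤ) else 0) = p := by
      rcases Nat.eq_zero_or_pos (p : ℕ) with h0 | h0
      · simp [h0]
      · have hlt : (p : ℕ) - 1 < m := by have := p.2; omega
        rw [Finset.sum_eq_single (⟨p - 1, hlt⟩ : Fin m)]
        · rw [if_pos]
          exact Nat.sub_add_cancel h0
        · intro b _ hb
          rw [if_neg]
          intro h
          exact hb (Fin.ext (by simp only; omega))
        · simp
    rw [hsum, Finset.sum_ite_eq' univ p, if_pos (mem_univ p)] at hdiff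
    rw [if_pos rfl, Int.modEq_iff_dvd, Nfun_eq, Nfun_eq]
    by_cases hp : (p : ℕ) + 1 < m
    · rw [if_pos hp] at hdiff
      exact ⟨(desc u).card - (desc v).card, by linear_combination hdiff⟩
    · rw [if_neg hp] at hdiff
      have hm : (p : ℤ) + 1 = m := by have := p.2; omega
      exact ⟨(desc u).card - (desc v).card - 1, by linear_combination hdiff - hm⟩
  · have hlow := val_sub_one_of_ne_zero hℓ hi
    have hdesc : desc v = desc u := by
      ext r
      by_cases hr : r = p
      · subst hr
        simp only [mem_desc]
        refine exists_congr fun s => and_congr_right fun hs => ?_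
        rw [hv, hu, huv s (by rintro rfl; omega)]
        have := hval (hnext s hs)
        omega
      · by_cases hr' : (r : ℕ) + 1 = p
        · simp only [mem_desc]
          refine exists_congr fun s => and_congr_right fun hs => ?_
          obtain rfl : s = p := Fin.ext (by omega)
          rw [hv, hu, huv r hr]
          have := hval (hprev r hr')
          omega
        · exact hoff r hr hr'
    rw [if_neg hi, sub_zero]
    simp only [Nfun_eq, MajFun, hdesc]
    rfl

theorem eOp_eq_some {i : ZMod (ℓ + 1)} {w w' : Fin m → ZMod (ℓ + 1)} (h : eOp i w = some w') :
    ∃ p, Rf i w p = eps i w ∧ (∀ q, p < q → Rf i w q ≠ eps i w) ∧ w p = i ∧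
      w' = Function.update w p (i - 1) := by
  unfold eOp at h
  generalize hM : Finset.max (_ : Finset (Fin m)) = M at h
  induction M using WithBot.recBotCoe with
  | bot => cases h
  | coe p =>
    simp only [WithBot.recBotCoe_coe, Option.ite_none_right_eq_some, Option.some.injEq] at h
    refine ⟨p, (mem_filter.1 (Finset.mem_of_max hM)).2, fun q hq hq' => ?_, h.1, ?_⟩
    · exact absurd hq (not_lt.2 (Finset.le_max_of_eq (mem_filter.2 ⟨mem_univ q, hq'⟩) hM))
    · exact h.2.symm

theorem fOp_eq_some {i : ZMod (ℓ + 1)} {w w' : Fin m → ZMod (ℓ + 1)} (h : fOp i w = some w') :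
    ∃ p, Rf i w p = eps i w ∧ (∀ q, q < p → Rf i w q ≠ eps i w) ∧ w p = i - 1 ∧
      w' = Function.update w p i := by
  unfold fOp at h
  generalize hM : Finset.min (_ : Finset (Fin m)) = M at h
  induction M using WithTop.recTopCoe with
  | top => cases h
  | coe p =>
    simp only [WithTop.recTopCoe_coe, Option.ite_none_right_eq_some, Option.some.injEq] at h
    refine ⟨p, (mem_filter.1 (Finset.mem_of_min hM)).2, fun q hq hq' => ?_, h.1, ?_⟩
    · exact absurd hq (not_lt.2 (Finset.min_le_of_eq (mem_filter.2 ⟨mem_univ q, hq'⟩) hM))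
    · exact h.2.symm

end

/-- if `e_i(w)` is defined then `N(e_i(w)) ≡ N(w) − δ_{i,0} (mod m)`,
and if `f_i(w)` is defined then `N(f_i(w)) ≡ N(w) + δ_{i,0} (mod m)`. -/
theorem stmt_5 (ℓ m : ℕ) (hℓ : 1 ≤ ℓ) (hm : 1 ≤ m)
    (w : Fin m → ZMod (ℓ + 1)) (i : ZMod (ℓ + 1)) :
    (∀ w', eOp i w = some w' →
      (Nfun w' : ℤ) ≡ (Nfun w : ℤ) - (if i = 0 then 1 else 0) [ZMOD (m : ℤ)]) ∧
    (∀ w', fOp i w = some w' →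
      (Nfun w' : ℤ) ≡ (Nfun w : ℤ) + (if i = 0 then 1 else 0) [ZMOD (m : ℤ)]) := by
  have : Fact (1 < ℓ + 1) := ⟨by omega⟩
  have hne : i ≠ i + 1 := by simp
  have hne' : i ≠ i - 1 := by simp [eq_sub_iff_add_eq]
  constructor
  · intro w' h
    obtain ⟨p, hp, hmax, hwp, rfl⟩ := eOp_eq_some h
    refine Nfun_update_modEq hℓ w _ i p hwp (by simp)
      (fun s hs => Function.update_of_ne hs _ _) (fun q hq hwq => ?_) (fun q hq hwq => ?_)
    · have h1 := Rf_eq_succ i w p q hq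
      rw [hwp, hwq, if_pos rfl, if_pos (by ring)] at h1
      exact hmax q (by rw [Fin.lt_def]; omega) (by omega)
    · have h1 := Rf_eq_succ i w q p hq
      rw [hwp, hwq, if_pos rfl, if_neg hne] at h1
      have h2 := Rf_le_eps i w q
      omega
  · intro w' h
    obtain ⟨p, hp, hmin, hwp, rfl⟩ := fOp_eq_some h
    have key := Nfun_update_modEq hℓ (Function.update w p i) w i p (by simp) hwp
      (fun s hs => (Function.update_of_ne hs _ _).symm) (fun q hq hwq => ?_) (fun q hq hwq => ?_)
    · simpa using (key.add_right (if i = 0 then 1 else 0)).symm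
    · rw [Function.update_of_ne (by rintro rfl; omega)] at hwq
      have h1 := Rf_eq_succ i w p q hq
      rw [hwp, hwq, if_neg hne', if_pos (by ring)] at h1
      have h2 := Rf_le_eps i w q
      omega
    · rw [Function.update_of_ne (by rintro rfl; omega)] at hwq
      have h1 := Rf_eq_succ i w q p hq
      rw [hwp, hwq, if_pos rfl, if_pos (by ring)] at h1
      exact hmin q (by rw [Fin.lt_def]; omega) (by omega)

end GreensteinPaths
end

section
/- Let (λ_i)_{i∈I} be nonnegative integers with λ_i > 0 for at least one i ∈ I. Then for every word w of length m there exist k ≥ 0, indices i_1,…,i_k ∈ I and words u_0 = w, u_1, …, u_k of length m such that for every r ∈ {1,…,k} the number m_r := ε_{i_r}(u_{r−1}) − λ_{i_r} is a positive integer and u_r = e_{i_r}^{m_r}(u_{r−1}) with all m_r successive applications of e_{i_r} defined, and such that ε_i(u_k) ≤ λ_i for all i ∈ I. -/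
open Finset Polynomial

namespace GreensteinPaths

noncomputable section

attribute [local instance] Classical.propDecidable

variable {ℓ m : ℕ}

end

section

variable {ℓ m : ℕ}

theorem val_sub_one_add_one {x : ZMod (ℓ + 1)} (hx : x ≠ 0) : (x - 1).val + 1 = x.val := by
  have hpos : 0 < x.val := Nat.pos_of_ne_zero fun h => hx ((ZMod.val_eq_zero x).mp h)
  have hlt := ZMod.val_lt x
  have hone : (1 : ZMod (ℓ + 1)).val = 1 := ZMod.val_one'' (by omega)
  rw [ZMod.val_sub (by omega), hone]
  omega

theorem val_zero_sub_one : ((0 : ZMod (ℓ + 1)) - 1).val = ℓ := by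
  rw [zero_sub]
  exact ZMod.val_neg_one ℓ

theorem Rf_eq_of_val_eq_add_one (i : ZMod (ℓ + 1)) (w : Fin m → ZMod (ℓ + 1)) {p q : Fin m}
    (hq : (q : ℕ) = p + 1) :
    Rf i w p = (if i = w p then 1 else 0) + Rf i w q - (if i = w q + 1 then 1 else 0) := by
  have hfilter : univ.filter (fun s : Fin m => p < s)
      = insert q (univ.filter fun s : Fin m => q < s) := by
    ext s
    simp only [mem_filter, mem_univ, true_and, mem_insert, Fin.lt_def, Fin.ext_iff]
    omega
  unfold Rf
  rw [hfilter, sum_insert (by simp)]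
  ring

theorem Rf_eq_of_val_add_one_eq (i : ZMod (ℓ + 1)) (w : Fin m → ZMod (ℓ + 1)) {p : Fin m}
    (hp : (p : ℕ) + 1 = m) : Rf i w p = if i = w p then 1 else 0 := by
  have hfilter : univ.filter (fun s : Fin m => p < s) = ∅ := by
    ext s
    simp only [mem_filter, mem_univ, true_and, Fin.lt_def, notMem_empty, iff_false]
    omega
  unfold Rf
  rw [hfilter, sum_empty, add_zero]

theorem eps_eq_of_forall_le {i : ZMod (ℓ + 1)} {w : Fin m → ZMod (ℓ + 1)} {n : ℕ} {p : Fin m}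
    (hp : Rf i w p = n) (hle : ∀ q, Rf i w q ≤ n) : eps i w = n := by
  apply le_antisymm
  · exact Finset.sup_le fun q _ => Int.toNat_le.mpr (hle q)
  · have := Rf_le_eps i w p
    omega

/-- `p` is the position on which `e_i` acts: the largest index at which `R^i` attains its
maximum `ε_i`. -/
def IsPivot (i : ZMod (ℓ + 1)) (w : Fin m → ZMod (ℓ + 1)) (p : Fin m) : Prop :=
  Rf i w p = eps i w ∧ ∀ q, p < q → Rf i w q < eps i w

theorem exists_isPivot {i : ZMod (ℓ + 1)} {w : Fin m → ZMod (ℓ + 1)} (h : 0 < eps i w) :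
    ∃ p, IsPivot i w p := by
  have hne : (univ : Finset (Fin m)).Nonempty := by
    by_contra hemp
    rw [not_nonempty_iff_eq_empty] at hemp
    simp [eps, hemp] at h
  have hS : (univ.filter fun p => Rf i w p = (eps i w : ℤ)).Nonempty := by
    obtain ⟨p, -, hp⟩ := Finset.exists_mem_eq_sup univ hne fun p => (Rf i w p).toNat
    change eps i w = _ at hp
    exact ⟨p, by simp only [mem_filter, mem_univ, true_and]; omega⟩
  refine ⟨_, (mem_filter.mp (Finset.max'_mem _ hS)).2, fun q hq => ?_⟩
  refine lt_of_le_of_ne (Rf_le_eps i w q) fun heq => hq.not_ge ?_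
  exact Finset.le_max' _ _ (by simpa using heq)

namespace IsPivot

variable {i : ZMod (ℓ + 1)} {w : Fin m → ZMod (ℓ + 1)} {p q : Fin m}

theorem apply_eq (hp : IsPivot i w p) (h : 0 < eps i w) : w p = i := by
  by_contra hne
  have hne' : ¬ i = w p := fun h => hne h.symm
  by_cases hlast : (p : ℕ) + 1 = m
  · have := Rf_eq_of_val_add_one_eq i w hlast
    rw [hp.1, if_neg hne'] at this
    omega
  · have hR := Rf_eq_of_val_eq_add_one i w (p := p) (q := ⟨p + 1, by omega⟩) rfl
    have hlt := hp.2 ⟨p + 1, by omega⟩ (by simp [Fin.lt_def])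
    rw [hp.1, if_neg hne'] at hR
    split_ifs at hR <;> omega

theorem apply_succ_ne (hp : IsPivot i w p) (h : 0 < eps i w) (hq : (q : ℕ) = p + 1) :
    w q ≠ i - 1 := by
  intro hw
  have hR := Rf_eq_of_val_eq_add_one i w hq
  have hlt := hp.2 q (by rw [Fin.lt_def]; omega)
  rw [hp.1, if_pos (hp.apply_eq h).symm, if_pos (by rw [hw]; ring)] at hR
  omega

theorem apply_pred_ne (hℓ : 1 ≤ ℓ) (hp : IsPivot i w p) (h : 0 < eps i w)
    (hq : (p : ℕ) = q + 1) : w q ≠ i := by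
  have : Fact (1 < ℓ + 1) := ⟨by omega⟩
  intro hw
  have hR := Rf_eq_of_val_eq_add_one i w hq
  have hle := Rf_le_eps i w q
  rw [hp.1, if_pos hw.symm, if_neg (by rw [hp.apply_eq h]; simp)] at hR
  omega

theorem val_add_one_lt (hp : IsPivot i w p) (h : 2 ≤ eps i w) : (p : ℕ) + 1 < m := by
  by_contra hlast
  have := Rf_eq_of_val_add_one_eq i w (p := p) (by omega)
  rw [hp.1] at this
  split_ifs at this <;> omega

theorem eOp_eq (hp : IsPivot i w p) (h : 0 < eps i w) :
    eOp i w = some (Function.update w p (i - 1)) := by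
  have hmax (inst : DecidablePred fun p => Rf i w p = (eps i w : ℤ)) :
      (univ.filter fun p => Rf i w p = (eps i w : ℤ)).max = (p : WithBot (Fin m)) := by
    apply le_antisymm
    · refine Finset.max_le fun q hq => WithBot.coe_le_coe.mpr (le_of_not_gt fun hpq => ?_)
      exact (hp.2 q hpq).ne (mem_filter.mp hq).2
    · exact Finset.le_max (by simpa using hp.1)
  unfold eOp
  rw [hmax]
  exact if_pos (hp.apply_eq h)

theorem eps_update (hℓ : 1 ≤ ℓ) (hp : IsPivot i w p) (h : 0 < eps i w) :
    eps i (Function.update w p (i - 1)) + 1 = eps i w := by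
  have : Fact (1 < ℓ + 1) := ⟨by omega⟩
  have hwp := hp.apply_eq h
  have hself : i ≠ i - 1 := fun h => one_ne_zero (sub_eq_self.mp h.symm)
  have hR : ∀ q, Rf i (Function.update w p (i - 1)) q
      = Rf i w q - (if q = p then 1 else 0) - (if q < p then 2 else 0) := by
    intro q
    have hsum : ∑ s ∈ univ.filter (fun s : Fin m => q < s),
          ((if i = Function.update w p (i - 1) s then (1 : ℤ) else 0)
            - (if i = Function.update w p (i - 1) s + 1 then 1 else 0))
        = ∑ s ∈ univ.filter (fun s : Fin m => q < s),
          (((if i = w s then (1 : ℤ) else 0) - (if i = w s + 1 then 1 else 0))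
            - (if s = p then 2 else 0)) := by
      refine sum_congr rfl fun s _ => ?_
      by_cases hs : s = p
      · subst hs
        simp [hwp, hself]
      · simp [hs]
    unfold Rf
    rw [hsum, sum_sub_distrib, sum_ite_eq' _ p]
    by_cases hq : q = p
    · subst hq
      simp [hwp, hself]
    · simp [hq]
      ring
  have heps : eps i (Function.update w p (i - 1)) = eps i w - 1 := by
    refine eps_eq_of_forall_le (p := p) ?_ fun q => ?_
    · rw [hR, hp.1]
      simp
      omega
    · rw [hR]
      have hle := Rf_le_eps i w q
      rcases lt_trichotomy q p with hq | hq | hq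
      · simp [hq, hq.ne]
        omega
      · simp [hq, hp.1]
        omega
      · have := hp.2 q hq
        simp [hq.ne', hq.not_gt]
        omega
  omega

end IsPivot

/-- The word obtained from `w` by subtracting `j` from all letters. -/
def shift (j : ZMod (ℓ + 1)) (w : Fin m → ZMod (ℓ + 1)) : Fin m → ZMod (ℓ + 1) :=
  fun s => w s - j

theorem MajFun_le (w : Fin m → ZMod (ℓ + 1)) : MajFun w ≤ m * m := by
  unfold MajFun
  calc ∑ r ∈ desc w, ((r : ℕ) + 1) ≤ ∑ _r ∈ desc w, m := sum_le_sum fun r _ => r.isLt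
    _ = (desc w).card * m := by simp
    _ ≤ m * m := Nat.mul_le_mul_right m (card_le_univ _ |>.trans_eq (Fintype.card_fin m))

theorem mem_desc_iff {w : Fin m → ZMod (ℓ + 1)} {r s : Fin m} (hs : (s : ℕ) = r + 1) :
    r ∈ desc w ↔ (w s).val < (w r).val := by
  have hs' : s = ⟨r + 1, hs ▸ s.isLt⟩ := Fin.ext hs
  have hr : (r : ℕ) + 1 < m := hs ▸ s.isLt
  rw [hs']
  simp [desc, hr]

theorem notMem_desc_of_val_add_one_eq {w : Fin m → ZMod (ℓ + 1)} {r : Fin m}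
    (hr : (r : ℕ) + 1 = m) : r ∉ desc w := by
  simp [desc, hr]

theorem mem_desc_update_iff {w : Fin m → ZMod (ℓ + 1)} {p r : Fin m} {a : ZMod (ℓ + 1)}
    (hrp : r ≠ p) (hpr : (p : ℕ) ≠ r + 1) : r ∈ desc (Function.update w p a) ↔ r ∈ desc w := by
  by_cases hr : (r : ℕ) + 1 = m
  · simp [notMem_desc_of_val_add_one_eq hr]
  · have hne : (⟨r + 1, by omega⟩ : Fin m) ≠ p := fun h => hpr (by rw [← h])
    rw [mem_desc_iff (s := ⟨r + 1, by omega⟩) rfl, mem_desc_iff (s := ⟨r + 1, by omega⟩) rfl,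
      Function.update_of_ne hne, Function.update_of_ne hrp]

/-- Lowering a nonzero letter `v p` by one preserves the descent set, provided the neighbouring
letters are as they are at a position where `e_i` acts. -/
theorem desc_update_of_ne_zero {v : Fin m → ZMod (ℓ + 1)} {p : Fin m} (h0 : v p ≠ 0)
    (hsucc : ∀ q : Fin m, (q : ℕ) = p + 1 → v q ≠ v p - 1)
    (hpred : ∀ q : Fin m, (p : ℕ) = q + 1 → v q ≠ v p) :
    desc (Function.update v p (v p - 1)) = desc v := by
  have hval := val_sub_one_add_one h0
  ext r
  by_cases hrp : r = p
  · subst hrp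
    by_cases hr : (r : ℕ) + 1 = m
    · simp [notMem_desc_of_val_add_one_eq hr]
    · have hne : (⟨r + 1, by omega⟩ : Fin m) ≠ r := by simp [Fin.ext_iff]
      have hv := (ZMod.val_injective (ℓ + 1)).ne (hsucc ⟨r + 1, by omega⟩ rfl)
      rw [mem_desc_iff (s := ⟨r + 1, by omega⟩) rfl, mem_desc_iff (s := ⟨r + 1, by omega⟩) rfl,
        Function.update_of_ne hne, Function.update_self]
      omega
  by_cases hpr : (p : ℕ) = r + 1
  · have hv := (ZMod.val_injective (ℓ + 1)).ne (hpred r hpr)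
    rw [mem_desc_iff hpr, mem_desc_iff hpr, Function.update_of_ne hrp, Function.update_self]
    omega
  · exact mem_desc_update_iff hrp hpr

/-- Replacing a letter `0` by `ℓ` raises the major index by one, provided the neighbouring
letters are as they are at a position where `e_0` acts which is not the last one. -/
theorem MajFun_update_of_eq_zero {v : Fin m → ZMod (ℓ + 1)} {p : Fin m} (h0 : v p = 0)
    (hlast : (p : ℕ) + 1 < m)
    (hsucc : ∀ q : Fin m, (q : ℕ) = p + 1 → v q ≠ 0 - 1)
    (hpred : ∀ q : Fin m, (p : ℕ) = q + 1 → v q ≠ 0) :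
    MajFun (Function.update v p (0 - 1)) = MajFun v + 1 := by
  have hne : (⟨p + 1, hlast⟩ : Fin m) ≠ p := by simp [Fin.ext_iff]
  have hmem : p ∈ desc (Function.update v p (0 - 1)) := by
    have hv := (ZMod.val_injective (ℓ + 1)).ne (hsucc ⟨p + 1, hlast⟩ rfl)
    have hlt := ZMod.val_lt (v ⟨p + 1, hlast⟩)
    rw [val_zero_sub_one] at hv
    rw [mem_desc_iff (s := ⟨p + 1, hlast⟩) rfl, Function.update_of_ne hne, Function.update_self,
      val_zero_sub_one]
    omega
  have hnotMem : p ∉ desc v := by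
    rw [mem_desc_iff (s := ⟨p + 1, hlast⟩) rfl, h0, ZMod.val_zero]
    omega
  by_cases hp0 : (p : ℕ) = 0
  · have hdesc : desc (Function.update v p (0 - 1)) = insert p (desc v) := by
      ext r
      by_cases hrp : r = p
      · subst hrp
        simp only [hmem, mem_insert, true_or]
      · rw [mem_insert, mem_desc_update_iff hrp (by omega)]
        simp [hrp]
    unfold MajFun
    rw [hdesc, sum_insert hnotMem]
    omega
  · obtain ⟨q, hq⟩ : ∃ q : Fin m, (p : ℕ) = q + 1 := ⟨⟨p - 1, by omega⟩, by simp; omega⟩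
    have hqp : q ≠ p := by
      rintro rfl
      omega
    have hqmem : q ∈ desc v := by
      rw [mem_desc_iff hq, h0, ZMod.val_zero]
      exact Nat.pos_of_ne_zero fun h => hpred q hq ((ZMod.val_eq_zero _).mp h)
    have hqnotMem : q ∉ desc (Function.update v p (0 - 1)) := by
      have hlt := ZMod.val_lt (v q)
      rw [mem_desc_iff hq, Function.update_of_ne hqp, Function.update_self, val_zero_sub_one]
      omega
    have hdesc : insert q (desc (Function.update v p (0 - 1))) = insert p (desc v) := by
      ext r
      by_cases hrp : r = p
      · subst hrp
        simp only [hmem, mem_insert, true_or, or_true]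
      by_cases hrq : r = q
      · subst hrq
        simp [hqmem]
      have hpr : (p : ℕ) ≠ r + 1 := fun h => hrq (Fin.ext (by omega))
      simp [hrp, hrq, mem_desc_update_iff hrp hpr]
    have hsum := congrArg (fun S : Finset (Fin m) => ∑ r ∈ S, ((r : ℕ) + 1)) hdesc
    simp only [sum_insert hqnotMem, sum_insert hnotMem] at hsum
    unfold MajFun
    omega

/-- A measure that strictly decreases under every `e_i` with `i ≠ j`, and under `e_j` on words
with `ε_j ≥ 2`. -/
def potential (j : ZMod (ℓ + 1)) (w : Fin m → ZMod (ℓ + 1)) : ℕ :=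
  (m * m - MajFun (shift j w)) * (ℓ + 1) + ∑ s, (shift j w s).val

theorem sum_val_update (v : Fin m → ZMod (ℓ + 1)) (p : Fin m) (a : ZMod (ℓ + 1)) :
    ∑ s, (Function.update v p a s).val + (v p).val = ∑ s, (v s).val + a.val := by
  rw [← add_sum_erase univ (fun s => (Function.update v p a s).val) (mem_univ p),
    ← add_sum_erase univ (fun s => (v s).val) (mem_univ p), Function.update_self,
    sum_congr rfl fun s hs => by rw [Function.update_of_ne (ne_of_mem_erase hs)]]
  ring

theorem shift_update (j : ZMod (ℓ + 1)) (w : Fin m → ZMod (ℓ + 1)) (p : Fin m)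
    (a : ZMod (ℓ + 1)) : shift j (Function.update w p a) = Function.update (shift j w) p (a - j) := by
  ext s
  by_cases hs : s = p
  · subst hs
    simp [shift]
  · simp [shift, hs]

theorem IsPivot.potential_update_lt (hℓ : 1 ≤ ℓ) {i j : ZMod (ℓ + 1)} {w : Fin m → ZMod (ℓ + 1)}
    {p : Fin m} (hp : IsPivot i w p) (h : 0 < eps i w) (hj : i = j → 2 ≤ eps i w) :
    potential j (Function.update w p (i - 1)) < potential j w := by
  have hvp : shift j w p = i - j := by simp [shift, hp.apply_eq h]
  have hsucc : ∀ q : Fin m, (q : ℕ) = p + 1 → shift j w q ≠ i - j - 1 := fun q hq heq =>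
    hp.apply_succ_ne h hq (sub_left_injective (b := j) (heq.trans (by ring)))
  have hpred : ∀ q : Fin m, (p : ℕ) = q + 1 → shift j w q ≠ i - j := fun q hq heq =>
    hp.apply_pred_ne hℓ h hq (sub_left_injective (b := j) (heq.trans (by ring)))
  have hsum := sum_val_update (shift j w) p (i - j - 1)
  unfold potential
  rw [shift_update, show i - 1 - j = i - j - 1 by ring]
  by_cases hij : i = j
  · rw [sub_eq_zero.mpr hij] at *
    have hMaj := MajFun_update_of_eq_zero hvp (hp.val_add_one_lt (hj hij)) hsucc hpred
    have hle := MajFun_le (Function.update (shift j w) p (0 - 1))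
    rw [val_zero_sub_one, hvp, ZMod.val_zero] at hsum
    have hdiff : m * m - MajFun (shift j w)
        = (m * m - MajFun (Function.update (shift j w) p (0 - 1))) + 1 := by omega
    rw [hdiff, add_one_mul]
    omega
  · have hne : i - j ≠ 0 := sub_ne_zero.mpr hij
    have hdesc : desc (Function.update (shift j w) p (i - j - 1)) = desc (shift j w) := by
      rw [← hvp] at hne hsucc hpred ⊢
      exact desc_update_of_ne_zero hne hsucc hpred
    have hval := val_sub_one_add_one hne
    have hMaj : MajFun (Function.update (shift j w) p (i - j - 1)) = MajFun (shift j w) := by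
      unfold MajFun
      rw [hdesc]
    rw [hMaj]
    rw [hvp] at hsum
    omega

theorem exists_eIter_eq_some (hℓ : 1 ≤ ℓ) (j i : ZMod (ℓ + 1)) (n : ℕ)
    (w : Fin m → ZMod (ℓ + 1)) (hn : n ≤ eps i w) (hj : i = j → n + 1 ≤ eps i w) :
    ∃ w', eIter i n w = some w' ∧ potential j w' + n ≤ potential j w := by
  induction n generalizing w with
  | zero => exact ⟨w, rfl, le_rfl⟩
  | succ n ih =>
    have hpos : 0 < eps i w := by omega
    obtain ⟨p, hp⟩ := exists_isPivot hpos
    have heps := hp.eps_update hℓ hpos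
    have hlt := hp.potential_update_lt hℓ (j := j) hpos fun hij => by
      have := hj hij
      omega
    obtain ⟨w', hw', hle⟩ := ih (Function.update w p (i - 1)) (by omega) fun hij => by
      have := hj hij
      omega
    refine ⟨w', ?_, by omega⟩
    rw [eIter, hp.eOp_eq hpos, Option.bind_some, hw']

end

/-- given nonnegative integers `(λ_i)_{i∈I}`, not all zero, every
word `w` of length `m` can be brought, by successively applying powers
`e_{i_r}^{m_r}` with `m_r = ε_{i_r}(u_{r−1}) − λ_{i_r} > 0` (all
applications defined), to a word `u_k` with `ε_i(u_k) ≤ λ_i` for all `i`. -/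
theorem stmt_10 (ℓ m : ℕ) (hℓ : 1 ≤ ℓ) (hm : 1 ≤ m)
    (lam : ZMod (ℓ + 1) → ℕ) (hlam : ∃ i, 0 < lam i)
    (w : Fin m → ZMod (ℓ + 1)) :
    ∃ (k : ℕ) (idx : Fin k → ZMod (ℓ + 1))
      (u : Fin (k + 1) → Fin m → ZMod (ℓ + 1)),
      u 0 = w ∧
      (∀ r : Fin k,
        lam (idx r) < eps (idx r) (u r.castSucc) ∧
        eIter (idx r) (eps (idx r) (u r.castSucc) - lam (idx r)) (u r.castSucc)
          = some (u r.succ)) ∧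
      (∀ i : ZMod (ℓ + 1), eps i (u (Fin.last k)) ≤ lam i) := by
  obtain ⟨j, hj⟩ := hlam
  induction hN : potential j w using Nat.strong_induction_on generalizing w with
  | _ N ih =>
    by_cases hw : ∀ i, eps i w ≤ lam i
    · exact ⟨0, Fin.elim0, fun _ => w, rfl, fun r => r.elim0, hw⟩
    push Not at hw
    obtain ⟨i, hi⟩ := hw
    obtain ⟨w', hw', hlt⟩ := exists_eIter_eq_some hℓ j i (eps i w - lam i) w (by omega)
      (by rintro rfl; omega)
    obtain ⟨k, idx, u, hu0, hstep, hlast⟩ := ih (potential j w') (by omega) w' rfl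
    refine ⟨k + 1, Fin.cons i idx, Fin.cons w u, rfl, fun r => ?_, fun a => ?_⟩
    · refine Fin.cases ?_ (fun r => ?_) r
      · simpa [hu0] using And.intro hi hw'
      · simpa [← Fin.succ_castSucc] using hstep r
    · simpa [← Fin.succ_last] using hlast a

end GreensteinPaths
end

section
/- Let k_0,…,k_ℓ be nonnegative integers with k_0 + ⋯ + k_ℓ = m ≥ 1. Then in ℚ[q] one has the identity Σ_{n=0}^{m−1} C(k_0,…,k_ℓ;n)·q^n = Σ_{d ∣ m} C̃(k_0,…,k_ℓ;d)·(1 + q^d + q^{2d} + ⋯ + q^{m−d}). -/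
open Finset Polynomial

namespace GreensteinPaths

noncomputable section

attribute [local instance] Classical.propDecidable

variable {ℓ m : ℕ}

end

/-- For a set of primes `s`, `∏ p ∈ s, (1 - 1/p)` expands as a Möbius sum. -/
lemma prod_one_sub_inv_eq_sum_moebius {s : Finset ℕ} (hs : ∀ p ∈ s, p.Prime) :
    ∏ p ∈ s, (1 - (p : ℚ)⁻¹)
      = ∑ t ∈ (∏ p ∈ s, p).divisors, (ArithmeticFunction.moebius t : ℚ) * (t : ℚ)⁻¹ := by
  let inv : ArithmeticFunction ℚ := ⟨fun t => (t : ℚ)⁻¹, by simp⟩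
  have hinv : inv.IsMultiplicative := by
    refine ⟨?_, ?_⟩
    · change (((1 : ℕ) : ℚ))⁻¹ = 1
      simp
    · intro a b _
      change (((a * b : ℕ) : ℚ))⁻¹ = (a : ℚ)⁻¹ * (b : ℚ)⁻¹
      rw [Nat.cast_mul, mul_inv]
  have hsq : Squarefree (∏ p ∈ s, p) := by
    refine Finset.squarefree_prod_of_pairwise_isCoprime ?_ fun p hp => (hs p hp).squarefree
    intro p hp q hq hpq
    exact Nat.coprime_iff_isRelPrime.mp ((Nat.coprime_primes (hs p hp) (hs q hq)).mpr hpq)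
  have h := hinv.prodPrimeFactors_one_sub_of_squarefree inv hsq
  rw [Nat.primeFactors_prod hs] at h
  exact h

/-- The totient of a product: the primes of `g` not dividing `f` contribute `1 - 1/p`. -/
lemma totient_mul_eq_mul_prod_filter {g f : ℕ} (hg : g ≠ 0) (hf : f ≠ 0) :
    (Nat.totient (g * f) : ℚ)
      = g * Nat.totient f * ∏ p ∈ g.primeFactors.filter (fun p => ¬ p ∣ f), (1 - (p : ℚ)⁻¹) := by
  have hunion : (g * f).primeFactors
      = f.primeFactors ∪ g.primeFactors.filter (fun p => ¬ p ∣ f) := by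
    rw [Nat.primeFactors_mul hg hf]
    ext p
    simp only [mem_union, mem_filter, Nat.mem_primeFactors]
    tauto
  have hdisj : Disjoint f.primeFactors (g.primeFactors.filter (fun p => ¬ p ∣ f)) := by
    rw [Finset.disjoint_left]
    intro p hp hp'
    exact (mem_filter.mp hp').2 (Nat.dvd_of_mem_primeFactors hp)
  rw [Nat.totient_eq_mul_prod_factors, Nat.totient_eq_mul_prod_factors f, hunion,
    prod_union hdisj]
  push_cast
  ring

/-- Hölder's evaluation of Ramanujan's sum. -/
lemma sum_divisors_mul_moebius {g f : ℕ} (hg : g ≠ 0) (hf : f ≠ 0) :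
    ∑ d ∈ g.divisors, (d : ℚ) * (ArithmeticFunction.moebius (g * f / d) : ℚ)
      = (Nat.totient (g * f) : ℚ) * (ArithmeticFunction.moebius f : ℚ) / Nat.totient f := by
  have hφ : (Nat.totient f : ℚ) ≠ 0 := by
    exact_mod_cast (Nat.totient_pos.mpr (Nat.pos_of_ne_zero hf)).ne'
  have hs : ∀ p ∈ g.primeFactors.filter (fun p => ¬ p ∣ f), p.Prime := fun p hp =>
    Nat.prime_of_mem_primeFactors (mem_filter.mp hp).1
  have hr : (∏ p ∈ g.primeFactors.filter (fun p => ¬ p ∣ f), p) ∣ g :=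
    (prod_dvd_prod_of_subset _ _ _ (filter_subset _ _)).trans (Nat.prod_primeFactors_dvd g)
  have hrf : (∏ p ∈ g.primeFactors.filter (fun p => ¬ p ∣ f), p).Coprime f :=
    Nat.Coprime.prod_left fun p hp =>
      ((hs p hp).coprime_iff_not_dvd).mpr (mem_filter.mp hp).2
  rw [totient_mul_eq_mul_prod_filter hg hf, prod_one_sub_inv_eq_sum_moebius hs,
    ← Nat.sum_div_divisors g]
  have hrhs : ∀ S : ℚ, (g : ℚ) * Nat.totient f * S * (ArithmeticFunction.moebius f : ℚ)
      / Nat.totient f = g * (ArithmeticFunction.moebius f : ℚ) * S := by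
    intro S
    field_simp
  have hquot : ∀ t c : ℕ, t ≠ 0 → c ≠ 0 → t * c * f / (t * c / t) = t * f := by
    intro t c ht0 hc0
    rw [Nat.mul_div_cancel_left _ (Nat.pos_of_ne_zero ht0), mul_right_comm,
      Nat.mul_div_cancel _ (Nat.pos_of_ne_zero hc0)]
  rw [hrhs, mul_sum]
  symm
  refine (sum_congr rfl ?_).trans (sum_subset (Nat.divisors_subset_of_dvd hg hr) ?_)
  · intro t ht
    have htr := Nat.dvd_of_mem_divisors ht
    obtain ⟨c, rfl⟩ := htr.trans hr
    obtain ⟨ht0, hc0⟩ := mul_ne_zero_iff.mp hg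
    rw [hquot t c ht0 hc0, Nat.mul_div_cancel_left _ (Nat.pos_of_ne_zero ht0),
      ArithmeticFunction.isMultiplicative_moebius.map_mul_of_coprime (hrf.coprime_dvd_left htr)]
    have : (t : ℚ) ≠ 0 := by exact_mod_cast ht0
    push_cast
    field_simp
  · intro t ht htr
    obtain ⟨c, rfl⟩ := Nat.dvd_of_mem_divisors ht
    obtain ⟨ht0, hc0⟩ := mul_ne_zero_iff.mp hg
    rw [hquot t c ht0 hc0]
    suffices h : ¬ Squarefree (t * f) by
      rw [ArithmeticFunction.moebius_eq_zero_of_not_squarefree h]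
      simp
    intro hsq
    refine htr (Nat.mem_divisors.mpr ⟨?_, ne_zero_of_dvd_ne_zero hg hr⟩)
    have hcop : t.Coprime f := Nat.coprime_of_squarefree_mul hsq
    refine (Nat.prod_primeFactors_of_squarefree hsq.of_mul_left).symm.dvd.trans ?_
    refine prod_dvd_prod_of_subset _ _ _ fun p hp => mem_filter.mpr ⟨?_, ?_⟩
    · exact Nat.primeFactors_mono (dvd_mul_right t c) hg hp
    · exact ((Nat.prime_of_mem_primeFactors hp).coprime_iff_not_dvd).mp
        (hcop.coprime_dvd_left (Nat.dvd_of_mem_primeFactors hp))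

lemma phiInt_eq_sum_divisors_gcd (n : ℕ) {e : ℕ} (he : e ≠ 0) :
    phiInt (n : ℤ) e
      = ∑ d ∈ (e.gcd n).divisors, (d : ℚ) * (ArithmeticFunction.moebius (e / d) : ℚ) := by
  have hg : e.gcd n ≠ 0 := Nat.gcd_ne_zero_left he
  have hmul : e.gcd n * (e / e.gcd n) = e := Nat.mul_div_cancel' (Nat.gcd_dvd_left e n)
  have hf : e / e.gcd n ≠ 0 := by
    intro h
    rw [h, mul_zero] at hmul
    exact he hmul.symm
  have h := sum_divisors_mul_moebius hg hf
  rw [hmul] at h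
  rw [h, phiInt, Int.natAbs_natCast]

lemma Ctil_eq_sum_multiples {ι : Type} [Fintype ι] {m : ℕ} (k : ι → ℕ) {d : ℕ}
    (hd : d ∈ m.divisors) :
    Ctil m k d = (1 / (m : ℚ)) * ∑ e ∈ m.divisors with d ∣ e,
      (d : ℚ) * (ArithmeticFunction.moebius (e / d) : ℚ) * multinomialQ m k e := by
  have hm := (Nat.mem_divisors.mp hd).2
  have hd0 : 0 < d := Nat.pos_of_mem_divisors hd
  rw [Ctil, div_eq_mul_one_div, mul_comm (d : ℚ), mul_assoc, mul_sum]
  congr 1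
  refine sum_bij' (fun d' _ => d * d') (fun e _ => e / d) ?_ ?_ ?_ ?_ ?_
  · intro d' h
    simp only [mem_filter, Nat.mem_divisors] at h ⊢
    exact ⟨⟨h.2, hm⟩, dvd_mul_right _ _⟩
  · intro e h
    simp only [mem_filter, Nat.mem_divisors] at h ⊢
    rw [Nat.mul_div_cancel' h.2]
    exact ⟨⟨(Nat.div_dvd_of_dvd h.2).trans h.1.1, hm⟩, h.1.1⟩
  · intro d' _
    exact Nat.mul_div_cancel_left _ hd0
  · intro e h
    exact Nat.mul_div_cancel' (mem_filter.mp h).2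
  · intro d' _
    simp only [Nat.mul_div_cancel_left _ hd0]
    ring

lemma Cfun_eq_sum_Ctil {ι : Type} [Fintype ι] {m : ℕ} (k : ι → ℕ) (n : ℕ) :
    Cfun m k (n : ℤ) = ∑ d ∈ m.divisors with d ∣ n, Ctil m k d := by
  rw [sum_congr rfl fun d hd => Ctil_eq_sum_multiples k (mem_filter.mp hd).1, ← mul_sum, Cfun]
  congr 1
  rw [sum_comm' (t' := m.divisors) (s' := fun e => (e.gcd n).divisors)]
  · refine sum_congr rfl fun e he => ?_
    rw [phiInt_eq_sum_divisors_gcd n (Nat.pos_of_mem_divisors he).ne', sum_mul]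
  · intro d e
    simp only [mem_filter, Nat.mem_divisors, Nat.dvd_gcd_iff]
    constructor
    · rintro ⟨⟨⟨_, hm⟩, hdn⟩, ⟨hem, _⟩, hde⟩
      exact ⟨⟨⟨hde, hdn⟩, Nat.gcd_ne_zero_left (ne_zero_of_dvd_ne_zero hm hem)⟩, hem, hm⟩
    · rintro ⟨⟨⟨hde, hdn⟩, _⟩, hem, hm⟩
      exact ⟨⟨⟨hde.trans hem, hm⟩, hdn⟩, ⟨hem, hm⟩, hde⟩

lemma sum_range_pow_mul_eq_sum_filter_dvd {R : Type*} [Semiring R] (x : R) {m d : ℕ}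
    (hd : d ∈ m.divisors) :
    ∑ j ∈ range (m / d), x ^ (j * d) = ∑ n ∈ range m with d ∣ n, x ^ n := by
  have hd0 : 0 < d := Nat.pos_of_mem_divisors hd
  have hdm : d ∣ m := Nat.dvd_of_mem_divisors hd
  refine sum_bij' (fun j _ => j * d) (fun n _ => n / d) ?_ ?_ ?_ ?_ ?_
  · intro j hj
    rw [mem_range] at hj
    exact mem_filter.mpr ⟨mem_range.mpr ((Nat.lt_div_iff_mul_lt_of_dvd hd0.ne' hdm).mp hj),
      dvd_mul_left _ _⟩
  · intro n hn
    obtain ⟨hn, hdn⟩ := mem_filter.mp hn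
    exact mem_range.mpr (Nat.div_lt_div_of_lt_of_dvd hdm (mem_range.mp hn))
  · intro j _
    exact Nat.mul_div_cancel _ hd0
  · intro n hn
    exact Nat.div_mul_cancel (mem_filter.mp hn).2
  · intro j _
    rfl

/-- in `ℚ[q]`,
`Σ_{n=0}^{m−1} C(k_0,…,k_ℓ;n) q^n = Σ_{d ∣ m} C̃(k_0,…,k_ℓ;d) (1 + q^d + ⋯ + q^{m−d})`. -/
theorem stmt_13 (ℓ : ℕ) (hℓ : 1 ≤ ℓ) (m : ℕ) (hm : 1 ≤ m)
    (k : Fin (ℓ + 1) → ℕ) (hk : ∑ j, k j = m) :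
    (∑ n ∈ Finset.range m, Polynomial.C (Cfun m k (n : ℤ)) * X ^ n : Polynomial ℚ)
      = ∑ d ∈ m.divisors, Polynomial.C (Ctil m k d) *
          ∑ j ∈ Finset.range (m / d), X ^ (j * d) := by
  have hL : ∀ n ∈ range m, (Polynomial.C (Cfun m k (n : ℤ)) * X ^ n : Polynomial ℚ)
      = ∑ d ∈ m.divisors with d ∣ n, Polynomial.C (Ctil m k d) * X ^ n := by
    intro n _
    rw [Cfun_eq_sum_Ctil, map_sum, sum_mul]
  have hR : ∀ d ∈ m.divisors, (Polynomial.C (Ctil m k d) *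
      ∑ j ∈ range (m / d), X ^ (j * d) : Polynomial ℚ)
      = ∑ n ∈ range m with d ∣ n, Polynomial.C (Ctil m k d) * X ^ n := by
    intro d hd
    rw [sum_range_pow_mul_eq_sum_filter_dvd X hd, mul_sum]
  rw [sum_congr rfl hL, sum_congr rfl hR]
  refine sum_comm' fun n d => ?_
  simp only [mem_filter]
  tauto

end GreensteinPaths
end

section
/- Let k_0,…,k_ℓ be nonnegative integers with k_0 + ⋯ + k_ℓ = m ≥ 1, let d be a divisor of m, and let ζ ∈ ℂ be a primitive d-th root of unity. Then Σ_{r ∣ m} C̃(k_0,…,k_ℓ;r)·(1 + ζ^r + ζ^{2r} + ⋯ + ζ^{m−r}) = (m/d)!/((k_0/d)!⋯(k_ℓ/d)!), where the right-hand side is 0 unless d divides every k_j. -/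
open Finset Polynomial

namespace GreensteinPaths

noncomputable section

attribute [local instance] Classical.propDecidable

variable {ℓ m : ℕ}

end

/-- The sum over all divisors of the Möbius function detects `1`. -/
lemma sum_divisors_moebius (n : ℕ) :
    ∑ e ∈ n.divisors, ArithmeticFunction.moebius e = if n = 1 then 1 else 0 := by
  rw [← ArithmeticFunction.coe_mul_zeta_apply, ArithmeticFunction.moebius_mul_coe_zeta,
    ArithmeticFunction.one_apply]

/-- Möbius inversion over the multiples of `d` dividing `m`. -/
lemma sum_moebius_multiples {R : Type*} [CommRing R] {m d : ℕ} (hm : m ≠ 0) (hd : d ∣ m)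
    (f : ℕ → R) :
    ∑ r ∈ m.divisors with d ∣ r, ∑ e ∈ m.divisors with r * e ∣ m,
      (ArithmeticFunction.moebius e : R) * f (r * e) = f d := by
  have hd0 : 0 < d := Nat.pos_of_dvd_of_pos hd (Nat.pos_of_ne_zero hm)
  have regroup : ∑ r ∈ m.divisors with d ∣ r, ∑ e ∈ m.divisors with r * e ∣ m,
      (ArithmeticFunction.moebius e : R) * f (r * e)
      = ∑ n ∈ m.divisors with d ∣ n, ∑ e ∈ (n / d).divisors,
        (ArithmeticFunction.moebius e : R) * f n := by
    rw [Finset.sum_sigma', Finset.sum_sigma']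
    refine Finset.sum_bij' (fun x _ => ⟨x.1 * x.2, x.2⟩) (fun x _ => ⟨x.1 / x.2, x.2⟩)
      ?_ ?_ ?_ ?_ ?_
    · rintro ⟨r, e⟩ h
      simp only [mem_sigma, mem_filter, Nat.mem_divisors] at h ⊢
      obtain ⟨⟨-, c, rfl⟩, -, hre⟩ := h
      have hpos : 0 < d * c * e := Nat.pos_of_dvd_of_pos hre (Nat.pos_of_ne_zero hm)
      rw [mul_assoc d c e, Nat.mul_div_cancel_left _ hd0]
      refine ⟨⟨⟨by rwa [← mul_assoc], hm⟩, dvd_mul_right _ _⟩, dvd_mul_left _ _, ?_⟩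
      rintro h0
      simp [mul_assoc, h0] at hpos
    · rintro ⟨n, e⟩ h
      simp only [mem_sigma, mem_filter, Nat.mem_divisors] at h ⊢
      obtain ⟨⟨⟨hn, -⟩, c, rfl⟩, he, hc⟩ := h
      rw [Nat.mul_div_cancel_left _ hd0] at he hc
      obtain ⟨b, rfl⟩ := he
      have he0 : 0 < e := Nat.pos_of_ne_zero (left_ne_zero_of_mul hc)
      have hdiv : d * (e * b) / e = d * b := by
        rw [mul_left_comm, Nat.mul_div_cancel_left _ he0]
      rw [hdiv]
      have hn' : d * b * e ∣ m := by rwa [mul_assoc, mul_comm b e]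
      exact ⟨⟨⟨(dvd_mul_right _ _).trans hn', hm⟩, dvd_mul_right _ _⟩,
        ⟨(dvd_mul_left _ _).trans hn', hm⟩, hn'⟩
    · rintro ⟨r, e⟩ h
      simp only [mem_sigma, mem_filter, Nat.mem_divisors] at h
      have he0 : 0 < e := Nat.pos_of_dvd_of_pos h.2.1.1 (Nat.pos_of_ne_zero hm)
      simp [Nat.mul_div_cancel _ he0]
    · rintro ⟨n, e⟩ h
      simp only [mem_sigma, mem_filter, Nat.mem_divisors] at h
      have hen : e ∣ n := h.2.1.trans (Nat.div_dvd_of_dvd h.1.2)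
      simp [Nat.div_mul_cancel hen]
    · rintro ⟨r, e⟩ _
      rfl
  rw [regroup, Finset.sum_eq_single_of_mem d (by simp [hd, hm])]
  · simp [Nat.div_self hd0]
  · intro n hn hnd
    have hdn : d ∣ n := (mem_filter.mp hn).2
    have hne : n / d ≠ 1 := fun h => hnd (by
      rw [← Nat.div_mul_cancel hdn, h, one_mul])
    rw [← Finset.sum_mul, ← Int.cast_sum, sum_divisors_moebius, if_neg hne]
    simp

/-- For `d, r ∣ m`, the powers of `ζ ^ r` with `ζ` a primitive `d`-th root of unity sum to
`m / r` or to `0` over a range of length `m / r`, according to whether `d ∣ r`. -/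
lemma sum_range_primitiveRoot_pow {K : Type*} [Field K] {m d r : ℕ} {ζ : K}
    (hζ : IsPrimitiveRoot ζ d) (hd : d ∣ m) (hr : r ∣ m) :
    ∑ j ∈ Finset.range (m / r), ζ ^ (j * r) = if d ∣ r then ((m / r : ℕ) : K) else 0 := by
  simp_rw [mul_comm _ r, pow_mul]
  split_ifs with hdr
  · simp [(hζ.pow_eq_one_iff_dvd r).2 hdr]
  · have hne : ζ ^ r ≠ 1 := fun h => hdr ((hζ.pow_eq_one_iff_dvd r).1 h)
    rw [geom_sum_eq hne, ← pow_mul, Nat.mul_div_cancel' hr, (hζ.pow_eq_one_iff_dvd m).2 hd]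
    simp

/-- for `d ∣ m` and `ζ ∈ ℂ` a primitive `d`-th root of unity,
`Σ_{r ∣ m} C̃(k_0,…,k_ℓ;r) (1 + ζ^r + ⋯ + ζ^{m−r}) = (m/d)!/((k_0/d)!⋯(k_ℓ/d)!)`,
the right-hand side being `0` unless `d` divides every `k_j`. -/
theorem stmt_14 (ℓ : ℕ) (hℓ : 1 ≤ ℓ) (m : ℕ) (hm : 1 ≤ m)
    (k : Fin (ℓ + 1) → ℕ) (hk : ∑ j, k j = m)
    (d : ℕ) (hd : d ∣ m) (ζ : ℂ) (hζ : IsPrimitiveRoot ζ d) :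
    ∑ r ∈ m.divisors, (Ctil m k r : ℂ) * ∑ j ∈ Finset.range (m / r), ζ ^ (j * r)
      = (multinomialQ m k d : ℂ) := by
  have hm0 : m ≠ 0 := Nat.one_le_iff_ne_zero.mp hm
  rw [← sum_moebius_multiples hm0 hd (fun n => (multinomialQ m k n : ℂ)), Finset.sum_filter]
  refine Finset.sum_congr rfl fun r hr => ?_
  have hrm : r ∣ m := Nat.dvd_of_mem_divisors hr
  have hr0 : (r : ℂ) ≠ 0 := Nat.cast_ne_zero.2 (ne_zero_of_dvd_ne_zero hm0 hrm)
  have hmC : (m : ℂ) ≠ 0 := Nat.cast_ne_zero.2 hm0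
  rw [sum_range_primitiveRoot_pow hζ hd hrm]
  split_ifs
  · rw [Nat.cast_div hrm hr0, Ctil]
    push_cast
    field_simp
  · simp

end GreensteinPaths
end

section
/- Let d ≥ 1, m ≥ 0 and r ≥ 1 be integers and let k_1,…,k_r be nonnegative integers with k_1 + ⋯ + k_r = md. If d does not divide gcd(k_1,…,k_r), then the d-th cyclotomic polynomial Φ_d(q) divides the Gaussian multinomial [md; k_1,…,k_r]_q in ℤ[q]; equivalently, [md; k_1,…,k_r]_q vanishes at every primitive d-th root of unity. -/
open Finset Polynomial

namespace GreensteinPaths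

noncomputable section

attribute [local instance] Classical.propDecidable

variable {ℓ m : ℕ}

end

theorem qNat_eq_prod_cyclotomic {n : ℕ} (hn : 0 < n) :
    qNat n = ∏ e ∈ n.divisors.erase 1, cyclotomic e ℤ :=
  (prod_cyclotomic_eq_geom_sum hn ℤ).symm

theorem qFactorial_succ (n : ℕ) : qFactorial (n + 1) = qFactorial n * qNat (n + 1) :=
  Finset.prod_range_succ _ _

theorem qFactorial_eq_prod_cyclotomic_pow {n N : ℕ} (h : n ≤ N) :
    qFactorial n = ∏ e ∈ Icc 2 N, cyclotomic e ℤ ^ (n / e) := by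
  induction n with
  | zero => simp [qFactorial]
  | succ n ih =>
    have hdiv : (n + 1).divisors.erase 1 = (Icc 2 N).filter (· ∣ n + 1) := by
      ext e
      simp only [mem_erase, Nat.mem_divisors, mem_filter, mem_Icc]
      constructor
      · rintro ⟨h1, he, -⟩
        have := Nat.le_of_dvd n.succ_pos he
        have := Nat.pos_of_dvd_of_pos he n.succ_pos
        exact ⟨by omega, he⟩
      · rintro ⟨h1, he⟩
        exact ⟨by omega, he, by omega⟩
    rw [qFactorial_succ, ih (by omega), qNat_eq_prod_cyclotomic n.succ_pos, hdiv,
      Finset.prod_filter, ← Finset.prod_mul_distrib]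
    refine Finset.prod_congr rfl fun e _ => ?_
    rw [Nat.succ_div, pow_add]
    split_ifs <;> simp

theorem sum_div_le {ι : Type*} (s : Finset ι) (k : ι → ℕ) (e : ℕ) :
    ∑ j ∈ s, k j / e ≤ (∑ j ∈ s, k j) / e := by
  rcases e.eq_zero_or_pos with rfl | he
  · simp
  · rw [Nat.le_div_iff_mul_le he, Finset.sum_mul]
    exact Finset.sum_le_sum fun j _ => Nat.div_mul_le_self _ _

theorem qMultinomial_eq_prod_cyclotomic_pow {ι : Type} [Fintype ι] {n : ℕ} {k : ι → ℕ}
    (hk : ∑ j, k j = n) :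
    qMultinomial n k = ∏ e ∈ Icc 2 n, cyclotomic e ℤ ^ (n / e - ∑ j, k j / e) := by
  have hden : ∏ j, qFactorial (k j) = ∏ e ∈ Icc 2 n, cyclotomic e ℤ ^ (∑ j, k j / e) := by
    have hle (j : ι) : k j ≤ n :=
      hk ▸ Finset.single_le_sum (fun _ _ => Nat.zero_le _) (mem_univ j)
    simp_rw [fun j => qFactorial_eq_prod_cyclotomic_pow (hle j)]
    rw [Finset.prod_comm]
    simp_rw [Finset.prod_pow_eq_pow_sum]
  have hmonic : (∏ e ∈ Icc 2 n, cyclotomic e ℤ ^ (∑ j, k j / e)).Monic :=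
    monic_prod_of_monic _ _ fun e _ => (cyclotomic.monic e ℤ).pow _
  have hnum : qFactorial n = (∏ e ∈ Icc 2 n, cyclotomic e ℤ ^ (∑ j, k j / e)) *
      ∏ e ∈ Icc 2 n, cyclotomic e ℤ ^ (n / e - ∑ j, k j / e) := by
    rw [qFactorial_eq_prod_cyclotomic_pow le_rfl, ← Finset.prod_mul_distrib]
    refine Finset.prod_congr rfl fun e _ => ?_
    rw [← pow_add, Nat.add_sub_cancel' (hk ▸ sum_div_le univ k e)]
  rw [qMultinomial, if_pos hk, hden, hnum, mul_divByMonic_cancel_left _ hmonic]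

/-- if `k_1 + ⋯ + k_r = m·d` and `d` does not divide
`gcd(k_1,…,k_r)`, then the `d`-th cyclotomic polynomial divides the Gaussian
multinomial `[md; k_1,…,k_r]_q` in `ℤ[q]` (equivalently, the latter vanishes
at every primitive `d`-th root of unity). -/
theorem stmt_15 (d m r : ℕ) (hd : 1 ≤ d) (hr : 1 ≤ r)
    (k : Fin r → ℕ) (hk : ∑ j, k j = m * d)
    (hgcd : ¬ d ∣ Finset.univ.gcd k) :
    Polynomial.cyclotomic d ℤ ∣ qMultinomial (m * d) k := by
  obtain ⟨i, hi⟩ : ∃ i, ¬ d ∣ k i := by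
    simpa [Finset.dvd_gcd_iff] using hgcd
  have hlt : ∑ j, k j / d < m := by
    refine Nat.lt_of_mul_lt_mul_right (a := d) ?_
    rw [← hk, Finset.sum_mul]
    exact Finset.sum_lt_sum (fun j _ => Nat.div_mul_le_self _ _)
      ⟨i, mem_univ i, lt_of_le_of_ne (Nat.div_mul_le_self _ _)
        fun h => hi (Dvd.intro_left _ h)⟩
  have hd1 : d ≠ 1 := by
    rintro rfl
    exact hi (one_dvd _)
  have hmem : d ∈ Icc 2 (m * d) :=
    mem_Icc.2 ⟨by omega, Nat.le_mul_of_pos_left d (by omega)⟩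
  rw [qMultinomial_eq_prod_cyclotomic_pow hk]
  refine (dvd_pow_self _ ?_).trans (Finset.dvd_prod_of_mem _ hmem)
  rw [Nat.mul_div_cancel _ hd]
  omega

end GreensteinPaths
end

section
/- Let d ≥ 1, m ≥ 0 and r ≥ 1 be integers and let k_1,…,k_r be nonnegative integers with k_1 + ⋯ + k_r = m. Then [md; k_1·d,…,k_r·d]_q is congruent to the constant polynomial m!/(k_1!⋯k_r!) modulo Φ_d(q) in ℤ[q]; equivalently, the value of [md; k_1·d,…,k_r·d]_q at any primitive d-th root of unity equals the ordinary multinomial coefficient m!/(k_1!⋯k_r!). -/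
open Finset Polynomial

namespace GreensteinPaths

noncomputable section

attribute [local instance] Classical.propDecidable

variable {ℓ m : ℕ}

end

theorem qNat_add (a b : ℕ) : qNat (a + b) = qNat a + X ^ a * qNat b := by
  simp only [qNat, Finset.sum_range_add, pow_add, Finset.mul_sum]

theorem qNat_mul (a d : ℕ) : qNat (a * d) = qNat d * ∑ i ∈ Finset.range a, X ^ (i * d) := by
  induction a with
  | zero => simp [qNat]
  | succ a ih => rw [add_one_mul, qNat_add, ih, Finset.sum_range_succ]; ring

theorem qNat_monic {n : ℕ} (hn : n ≠ 0) : (qNat n).Monic :=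
  Polynomial.monic_geom_sum_X hn

theorem qFactorial_monic (n : ℕ) : (qFactorial n).Monic :=
  Polynomial.monic_prod_of_monic _ _ fun i _ => qNat_monic i.succ_ne_zero

theorem qFactorial_add (a b : ℕ) :
    qFactorial (a + b) = qFactorial a * ∏ i ∈ Finset.range b, qNat (a + i + 1) :=
  Finset.prod_range_add _ _ _

theorem qFactorial_mul_qFactorial_dvd (a b : ℕ) :
    qFactorial a * qFactorial b ∣ qFactorial (a + b) := by
  induction a generalizing b with
  | zero => simp [qFactorial]
  | succ a iha =>
    induction b with
    | zero => simp [qFactorial]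
    | succ b ihb =>
      have h : qFactorial (a + 1 + (b + 1)) =
          qFactorial (a + (b + 1)) * qNat (a + 1) +
            X ^ (a + 1) * (qFactorial (a + 1 + b) * qNat (b + 1)) := by
        rw [← add_assoc (a + 1) b 1, qFactorial_succ, add_assoc (a + 1) b 1, qNat_add,
          show a + (b + 1) = a + 1 + b by ring]
        ring
      rw [h]
      refine dvd_add ?_ (Dvd.dvd.mul_left ?_ _)
      · rw [qFactorial_succ a, mul_right_comm]
        exact mul_dvd_mul_right (iha (b + 1)) _
      · rw [qFactorial_succ b, ← mul_assoc]
        exact mul_dvd_mul_right ihb _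

theorem prod_qFactorial_dvd {ι : Type*} (s : Finset ι) (k : ι → ℕ) :
    ∏ j ∈ s, qFactorial (k j) ∣ qFactorial (∑ j ∈ s, k j) := by
  classical
  induction s using Finset.induction_on with
  | empty => simp
  | insert a s ha ih =>
    rw [Finset.prod_insert ha, Finset.sum_insert ha]
    exact (mul_dvd_mul_left _ ih).trans (qFactorial_mul_qFactorial_dvd _ _)

theorem prod_qFactorial_mul_qMultinomial {ι : Type} [Fintype ι] {n : ℕ} {k : ι → ℕ}
    (h : ∑ j, k j = n) :
    (∏ j, qFactorial (k j)) * qMultinomial n k = qFactorial n := by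
  have hm : (∏ j, qFactorial (k j)).Monic :=
    Polynomial.monic_prod_of_monic _ _ fun j _ => qFactorial_monic _
  obtain ⟨c, hc⟩ := prod_qFactorial_dvd Finset.univ k
  rw [h] at hc
  rw [qMultinomial, if_pos h, hc, Polynomial.mul_divByMonic_cancel_left _ hm]

section RootOfUnity

variable {K : Type*} [Field K] {ζ : K} {d : ℕ}

theorem aeval_qNat_mul_sub_one (ζ : K) (n : ℕ) : aeval ζ (qNat n) * (ζ - 1) = ζ ^ n - 1 := by
  simp [qNat, geom_sum_mul]

theorem aeval_qNat_ne_zero (hζ : IsPrimitiveRoot ζ d) {n : ℕ} (hn : n ≠ 0) (hnd : n < d) :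
    aeval ζ (qNat n) ≠ 0 := fun h => by
  have h1 := aeval_qNat_mul_sub_one ζ n
  rw [h, zero_mul, eq_comm, sub_eq_zero] at h1
  exact hζ.pow_ne_one_of_pos_of_lt hn hnd h1

theorem aeval_qFactorial_ne_zero (hζ : IsPrimitiveRoot ζ d) {n : ℕ} (hnd : n < d) :
    aeval ζ (qFactorial n) ≠ 0 := by
  rw [qFactorial, map_prod, Finset.prod_ne_zero_iff]
  intro i hi
  exact aeval_qNat_ne_zero hζ i.succ_ne_zero (by have := Finset.mem_range.1 hi; omega)

theorem aeval_qNat_mul_add (hζ : IsPrimitiveRoot ζ d) (hd : 1 < d) (a b : ℕ) :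
    aeval ζ (qNat (a * d + b)) = aeval ζ (qNat b) := by
  apply mul_right_cancel₀ (sub_ne_zero.2 (hζ.ne_one hd))
  rw [aeval_qNat_mul_sub_one, aeval_qNat_mul_sub_one, pow_add, mul_comm a d, pow_mul,
    hζ.pow_eq_one, one_pow, one_mul]

theorem exists_qFactorial_mul_eq (hζ : IsPrimitiveRoot ζ d) (hd : d ≠ 0) (m : ℕ) :
    ∃ G : ℤ[X], qFactorial (m * d) = qNat d ^ m * G ∧
      aeval ζ G = (m.factorial : K) * aeval ζ (qFactorial (d - 1)) ^ m := by
  induction m with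
  | zero => exact ⟨1, by simp [qFactorial], by simp⟩
  | succ m ih =>
    obtain ⟨G, hG, hGζ⟩ := ih
    obtain ⟨e, rfl⟩ := Nat.exists_eq_succ_of_ne_zero hd
    simp only [Nat.succ_eq_add_one, Nat.add_sub_cancel] at *
    refine ⟨G * (∏ b ∈ Finset.range e, qNat (m * (e + 1) + b + 1)) *
      ∑ i ∈ Finset.range (m + 1), X ^ (i * (e + 1)), ?_, ?_⟩
    · rw [add_one_mul, qFactorial_add, hG, Finset.prod_range_succ, add_assoc (m * (e + 1)) e 1,
        ← add_one_mul, qNat_mul]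
      ring
    · have hprod : ∏ b ∈ Finset.range e, aeval ζ (qNat (m * (e + 1) + b + 1)) =
          aeval ζ (qFactorial e) := by
        rw [qFactorial, map_prod]
        refine Finset.prod_congr rfl fun b hb => ?_
        rw [add_assoc, aeval_qNat_mul_add hζ (by have := Finset.mem_range.1 hb; omega)]
      have hsum : ∑ i ∈ Finset.range (m + 1), ζ ^ (i * (e + 1)) = (m + 1 : K) := by
        simp [mul_comm _ (e + 1), pow_mul, hζ.pow_eq_one]
      simp only [map_mul, map_prod, map_sum, map_pow, aeval_X, hprod, hsum, hGζ,
        Nat.factorial_succ, Nat.cast_mul, Nat.cast_add, Nat.cast_one]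
      ring

theorem aeval_qMultinomial_mul [CharZero K] {ι : Type} [Fintype ι] (hζ : IsPrimitiveRoot ζ d)
    (hd : d ≠ 0) {m : ℕ} {k : ι → ℕ} (hk : ∑ j, k j = m) :
    aeval ζ (qMultinomial (m * d) fun j => k j * d) = (Nat.multinomial Finset.univ k : K) := by
  choose G hG hGζ using exists_qFactorial_mul_eq hζ hd
  have hQ := prod_qFactorial_mul_qMultinomial (n := m * d) (k := fun j => k j * d)
    (by rw [← Finset.sum_mul, hk])
  simp only [hG, Finset.prod_mul_distrib, Finset.prod_pow_eq_pow_sum, hk, mul_assoc] at hQ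
  have h := congrArg (aeval ζ) (mul_left_cancel₀ (pow_ne_zero m (qNat_monic hd).ne_zero) hQ)
  simp only [map_mul, map_prod, hGζ, Finset.prod_mul_distrib, Finset.prod_pow_eq_pow_sum, hk] at h
  have hu := pow_ne_zero m (aeval_qFactorial_ne_zero hζ (Nat.sub_one_lt hd))
  have hf : ∏ j, ((k j).factorial : K) ≠ 0 :=
    Finset.prod_ne_zero_iff.2 fun j _ => Nat.cast_ne_zero.2 (Nat.factorial_ne_zero _)
  have hmult := congrArg (Nat.cast (R := K)) (Nat.multinomial_spec Finset.univ k)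
  rw [hk] at hmult
  push_cast at hmult
  apply mul_left_cancel₀ (mul_ne_zero hf hu)
  rw [h, ← hmult]
  ring

end RootOfUnity

/-- if `k_1 + ⋯ + k_r = m`, then the Gaussian multinomial
`[md; k_1 d, …, k_r d]_q` is congruent to the constant polynomial
`m!/(k_1!⋯k_r!)` modulo the `d`-th cyclotomic polynomial in `ℤ[q]`. -/
theorem stmt_16 (d m r : ℕ) (hd : 1 ≤ d) (hr : 1 ≤ r)
    (k : Fin r → ℕ) (hk : ∑ j, k j = m) :
    Polynomial.cyclotomic d ℤ ∣
      (qMultinomial (m * d) (fun j => k j * d)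
        - Polynomial.C (Nat.multinomial Finset.univ k : ℤ)) := by
  have hd0 : d ≠ 0 := Nat.one_le_iff_ne_zero.1 hd
  have hζ := Complex.isPrimitiveRoot_exp d hd0
  rw [Polynomial.cyclotomic_eq_minpoly hζ hd]
  apply minpoly.isIntegrallyClosed_dvd (hζ.isIntegral hd)
  rw [map_sub, aeval_qMultinomial_mul hζ hd0 hk]
  simp

end GreensteinPaths
end
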